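/- arXiv:1008.1966 — 2 statements merged into one kernel-verified Lean document; each statement's English description precedes it below -/
import Mathlib

section
/- For every n ≥ 1, the word [a, t⁻ⁿ·a·tⁿ] (which has length 4n+4) lies in the normal closure of R_Γ in F, and Area([a, t⁻ⁿ·a·tⁿ]) ≥ F_n, the n-th Fibonacci number. In particular the Dehn function of Baumslag's group Γ grows at least exponentially. -/
/-- The three generators of Baumslag's group. -/
inductive Letter : Type
  | a | s | t
  deriving DecidableEq

/-- The free group on `{a, s, t}`. -/
abbrev F : Type := FreeGroup Letter

def a : F := FreeGroup.of Letter.a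
def s : F := FreeGroup.of Letter.s
def t : F := FreeGroup.of Letter.t

/-- The commutator convention `[x, y] = x⁻¹ y⁻¹ x y`. -/
def cmm (x y : F) : F := x⁻¹ * y⁻¹ * x * y

/-- The relator set of Baumslag's presentation
`⟨a,s,t | [a, a^t] = 1, [s,t] = 1, a^s = a·a^t⟩`. -/
def RΓ : Set F :=
  {cmm a (t⁻¹ * a * t), cmm s t, (s⁻¹ * a * s)⁻¹ * a * (t⁻¹ * a * t)}

/-- `w` freely equals a product of `N` conjugates of elements of `R^±1`. -/
def IsConjProd (R : Set F) (N : ℕ) (w : F) : Prop :=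
  ∃ (u r : Fin N → F) (ε : Fin N → ℤ),
    (∀ i, r i ∈ R) ∧ (∀ i, ε i = 1 ∨ ε i = -1) ∧
    w = (List.ofFn fun i => u i * r i ^ ε i * (u i)⁻¹).prod

/-- `Area(w)`: the least `N` such that `w` freely equals a product of `N`
conjugates of relators or their inverses. -/
noncomputable def area (R : Set F) (w : F) : ℕ := sInf {N : ℕ | IsConjProd R N w}

namespace BaumslagGroup

/-- The Heisenberg element with vector part `(x, y)` and central part `z`, for the
determinant form on `ℤ²`. -/
def heis (x y z : ℤ) : Matrix (Fin 4) (Fin 4) ℤ :=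
  !![1, -y, x, z; 0, 1, 0, x; 0, 0, 1, y; 0, 0, 0, 1]

/-- The action of the Fibonacci matrix on the Heisenberg group; it has determinant `-1`
and so inverts the centre. -/
def fibAct : Matrix (Fin 4) (Fin 4) ℤ :=
  !![-1, 0, 0, 0; 0, 0, 1, 0; 0, 1, 1, 0; 0, 0, 0, 1]

/-- The inverse of `fibAct`. -/
def fibActInv : Matrix (Fin 4) (Fin 4) ℤ :=
  !![-1, 0, 0, 0; 0, -1, 1, 0; 0, 1, 0, 0; 0, 0, 0, 1]

theorem heis_mul (x y z x' y' z' : ℤ) :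
    heis x y z * heis x' y' z' = heis (x + x') (y + y') (z + z' + (x * y' - y * x')) := by
  ext i j
  fin_cases i <;> fin_cases j <;> simp [heis, Matrix.mul_apply, Fin.sum_univ_four] <;> ring

theorem heis_zero : heis 0 0 0 = 1 := by decide

theorem fibAct_mul_inv : fibAct * fibActInv = 1 := by decide

theorem fibActInv_mul : fibActInv * fibAct = 1 := by decide

/-- `heis` as an invertible matrix. -/
def heisUnit (x y z : ℤ) : (Matrix (Fin 4) (Fin 4) ℤ)ˣ where
  val := heis x y z
  inv := heis (-x) (-y) (-z)
  val_inv := by rw [heis_mul, ← heis_zero]; congr 1 <;> ring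
  inv_val := by rw [heis_mul, ← heis_zero]; congr 1 <;> ring

theorem heisUnit_mul (x y z x' y' z' : ℤ) :
    heisUnit x y z * heisUnit x' y' z' =
      heisUnit (x + x') (y + y') (z + z' + (x * y' - y * x')) :=
  Units.ext (heis_mul ..)

theorem heisUnit_inv (x y z : ℤ) : (heisUnit x y z)⁻¹ = heisUnit (-x) (-y) (-z) :=
  Units.ext rfl

theorem heisUnit_zero : heisUnit 0 0 0 = 1 := Units.ext heis_zero

theorem heisUnit_injective_center {z z' : ℤ} (h : heisUnit 0 0 z = heisUnit 0 0 z') :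
    z = z' := by
  simpa [heisUnit, heis] using congrArg (fun u : (Matrix (Fin 4) (Fin 4) ℤ)ˣ => u.val 0 3) h

/-- `fibAct` as an invertible matrix. -/
def fibUnit : (Matrix (Fin 4) (Fin 4) ℤ)ˣ :=
  ⟨fibAct, fibActInv, fibAct_mul_inv, fibActInv_mul⟩

theorem fibUnit_mul_heisUnit (x y z : ℤ) :
    fibUnit * heisUnit x y z = heisUnit y (x + y) (-z) * fibUnit := by
  apply Units.ext
  ext i j
  fin_cases i <;> fin_cases j <;>
    simp [fibUnit, heisUnit, heis, fibAct, Matrix.mul_apply, Fin.sum_univ_four]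

theorem fibUnit_conj (x y z : ℤ) :
    fibUnit * heisUnit x y z * fibUnit⁻¹ = heisUnit y (x + y) (-z) := by
  rw [fibUnit_mul_heisUnit, mul_inv_cancel_right]

/-- A linear representation of the free group, sending the relators of Baumslag's group to
the centre of the Heisenberg group. -/
def rep : F →* (Matrix (Fin 4) (Fin 4) ℤ)ˣ :=
  FreeGroup.lift fun
    | .a => heisUnit 1 0 0
    | .s => fibUnit⁻¹ ^ 2
    | .t => fibUnit⁻¹

theorem rep_a : rep a = heisUnit 1 0 0 := by simp [rep, a]

theorem rep_s : rep s = fibUnit⁻¹ ^ 2 := by simp [rep, s]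

theorem rep_t : rep t = fibUnit⁻¹ := by simp [rep, t]

theorem fibUnit_conj_pow (n : ℕ) : ∃ z : ℤ,
    fibUnit ^ (n + 1) * heisUnit 1 0 0 * (fibUnit ^ (n + 1))⁻¹ =
      heisUnit (Nat.fib n) (Nat.fib (n + 1)) z := by
  induction n with
  | zero => exact ⟨0, by simpa using fibUnit_conj 1 0 0⟩
  | succ n ih =>
    obtain ⟨z, hz⟩ := ih
    refine ⟨-z, ?_⟩
    rw [pow_succ' _ (n + 1), mul_inv_rev]
    have : fibUnit * fibUnit ^ (n + 1) * heisUnit 1 0 0 * ((fibUnit ^ (n + 1))⁻¹ * fibUnit⁻¹)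
        = fibUnit * (fibUnit ^ (n + 1) * heisUnit 1 0 0 * (fibUnit ^ (n + 1))⁻¹) * fibUnit⁻¹ := by
      group
    rw [this, hz, fibUnit_conj, Nat.fib_add_two]
    push_cast
    rfl

theorem rep_cmm_a_conj (n : ℕ) :
    rep (cmm a ((t ^ (n + 1))⁻¹ * a * t ^ (n + 1))) = heisUnit 0 0 (2 * Nat.fib (n + 1)) := by
  obtain ⟨z, hz⟩ := fibUnit_conj_pow n
  have h : rep ((t ^ (n + 1))⁻¹ * a * t ^ (n + 1)) =
      heisUnit (Nat.fib n) (Nat.fib (n + 1)) z := by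
    rw [← hz]; simp only [map_mul, map_inv, map_pow, rep_a, rep_t, inv_pow, inv_inv]
  simp only [cmm, map_mul, map_inv, h, rep_a, heisUnit_inv, heisUnit_mul]
  congr 1 <;> ring

theorem rep_relator {r : F} (hr : r ∈ RΓ) : ∃ z : ℤ, |z| ≤ 2 ∧ rep r = heisUnit 0 0 z := by
  rcases hr with rfl | rfl | rfl
  · exact ⟨2, by norm_num, by simpa using rep_cmm_a_conj 0⟩
  · refine ⟨0, by norm_num, ?_⟩
    simp only [cmm, map_mul, map_inv, rep_s, rep_t, heisUnit_zero]
    group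
  · have h := fibUnit_conj 1 0 0
    have h2 : fibUnit ^ 2 * heisUnit 1 0 0 * (fibUnit ^ 2)⁻¹ = heisUnit 1 1 0 := by
      have h3 := fibUnit_conj 0 1 0
      simp only [add_zero, zero_add, neg_zero] at h h3
      rw [← h3, ← h, sq, mul_inv_rev]; simp only [mul_assoc]
    refine ⟨1, by norm_num, ?_⟩
    have hrep : rep ((s⁻¹ * a * s)⁻¹ * a * (t⁻¹ * a * t)) =
        (fibUnit ^ 2 * heisUnit 1 0 0 * (fibUnit ^ 2)⁻¹)⁻¹ * heisUnit 1 0 0 *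
          (fibUnit * heisUnit 1 0 0 * fibUnit⁻¹) := by
      simp only [map_mul, map_inv, rep_s, rep_t, rep_a, inv_pow, inv_inv]
    rw [hrep, h2, h, heisUnit_inv, heisUnit_mul, heisUnit_mul]
    congr 1

theorem rep_conj_center (g : F) : ∃ e : ℤ, |e| = 1 ∧
    ∀ z, rep g * heisUnit 0 0 z * (rep g)⁻¹ = heisUnit 0 0 (e * z) := by
  have hfib (z : ℤ) : fibUnit⁻¹ * heisUnit 0 0 z * fibUnit⁻¹⁻¹ = heisUnit 0 0 (-z) := by
    have := fibUnit_conj 0 0 (-z)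
    simp only [add_zero, neg_neg] at this
    rw [← this]; group
  have hinv (g : F) (h : ∃ e : ℤ, |e| = 1 ∧
      ∀ z, rep g * heisUnit 0 0 z * (rep g)⁻¹ = heisUnit 0 0 (e * z)) : ∃ e : ℤ, |e| = 1 ∧
      ∀ z, rep g⁻¹ * heisUnit 0 0 z * (rep g⁻¹)⁻¹ = heisUnit 0 0 (e * z) := by
    obtain ⟨e, he, h⟩ := h
    refine ⟨e, he, fun z => ?_⟩
    have hee : e * (e * z) = z := by
      rw [← mul_assoc, ← abs_mul_abs_self, he]; ring
    have := h (e * z)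
    rw [hee] at this
    rw [← this, map_inv]; group
  induction g using FreeGroup.induction_on with
  | C1 => exact ⟨1, by norm_num, by simp⟩
  | of x =>
    cases x with
    | a =>
      refine ⟨1, by norm_num, fun z => ?_⟩
      change rep a * _ * (rep a)⁻¹ = _
      rw [rep_a, heisUnit_inv, heisUnit_mul, heisUnit_mul]
      congr 1; ring
    | s =>
      refine ⟨1, by norm_num, fun z => ?_⟩
      change rep s * _ * (rep s)⁻¹ = _
      have := hfib (-z)
      rw [← hfib z, neg_neg] at this
      rw [one_mul]
      refine Eq.trans ?_ this
      rw [rep_s, sq, mul_inv_rev]; simp only [mul_assoc]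
    | t =>
      refine ⟨-1, by norm_num, fun z => ?_⟩
      change rep t * _ * (rep t)⁻¹ = _
      rw [rep_t, hfib, neg_one_mul]
  | inv_of x h => exact hinv _ h
  | mul x y hx hy =>
    obtain ⟨e, he, hx⟩ := hx
    obtain ⟨e', he', hy⟩ := hy
    refine ⟨e * e', by rw [abs_mul, he, he', one_mul], fun z => ?_⟩
    rw [mul_assoc e, ← hx, ← hy, map_mul]; group

theorem rep_conj_relator {u r : F} {ε : ℤ} (hr : r ∈ RΓ) (hε : ε = 1 ∨ ε = -1) :
    ∃ z : ℤ, |z| ≤ 2 ∧ rep (u * r ^ ε * u⁻¹) = heisUnit 0 0 z := by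
  obtain ⟨z, hz, h⟩ := rep_relator hr
  obtain ⟨e, he, hu⟩ := rep_conj_center u
  rcases hε with rfl | rfl
  · exact ⟨e * z, by rwa [abs_mul, he, one_mul], by simp [← hu, h]⟩
  · refine ⟨e * -z, by rwa [abs_mul, he, one_mul, abs_neg], ?_⟩
    rw [← hu, map_mul, map_mul, map_inv, zpow_neg_one, map_inv, h, heisUnit_inv, neg_zero]

theorem rep_prod {l : List F}
    (hl : ∀ g ∈ l, ∃ z : ℤ, |z| ≤ 2 ∧ rep g = heisUnit 0 0 z) :
    ∃ z : ℤ, |z| ≤ 2 * l.length ∧ rep l.prod = heisUnit 0 0 z := by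
  induction l with
  | nil => exact ⟨0, by simp, by simp [heisUnit_zero]⟩
  | cons g l ih =>
    obtain ⟨z, hz, h⟩ := hl g (by simp)
    obtain ⟨z', hz', h'⟩ := ih fun g hg => hl g (by simp [hg])
    refine ⟨z + z', ?_, ?_⟩
    · have := abs_add_le z z'
      push_cast [List.length_cons]
      linarith
    · rw [List.prod_cons, map_mul, h, h', heisUnit_mul]
      congr 1; ring

theorem fib_le_of_isConjProd {n N : ℕ}
    (h : IsConjProd RΓ N (cmm a ((t ^ (n + 1))⁻¹ * a * t ^ (n + 1)))) :
    Nat.fib (n + 1) ≤ N := by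
  obtain ⟨u, r, ε, hr, hε, h⟩ := h
  obtain ⟨z, hz, hrep⟩ := rep_prod (l := List.ofFn fun i => u i * r i ^ ε i * (u i)⁻¹) <| by
    intro g hg
    obtain ⟨i, rfl⟩ := List.mem_ofFn.1 hg
    exact rep_conj_relator (hr i) (hε i)
  rw [← h, rep_cmm_a_conj] at hrep
  rw [← heisUnit_injective_center hrep, List.length_ofFn] at hz
  have := (le_abs_self _).trans hz
  lia

theorem exists_isConjProd_of_list {R : Set F} (l : List F)
    (hl : ∀ g ∈ l, ∃ u r : F, ∃ ε : ℤ, r ∈ R ∧ (ε = 1 ∨ ε = -1) ∧ g = u * r ^ ε * u⁻¹) :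
    IsConjProd R l.length l.prod := by
  choose u r ε hr hε h using fun i : Fin l.length => hl (l.get i) (l.get_mem i)
  refine ⟨u, r, ε, hr, hε, ?_⟩
  simp_rw [← h, List.ofFn_get]

theorem exists_list_of_mem_normalClosure {R : Set F} {w : F}
    (hw : w ∈ Subgroup.normalClosure R) : ∃ l : List F, w = l.prod ∧
      ∀ g ∈ l, ∃ u r : F, ∃ ε : ℤ, r ∈ R ∧ (ε = 1 ∨ ε = -1) ∧ g = u * r ^ ε * u⁻¹ := by
  induction hw using Subgroup.closure_induction with
  | mem x hx =>
    obtain ⟨r, hr, hx⟩ := Group.mem_conjugatesOfSet_iff.1 hx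
    obtain ⟨u, rfl⟩ := isConj_iff.1 hx
    exact ⟨[u * r * u⁻¹], by simp, fun g hg => ⟨u, r, 1, hr, Or.inl rfl, by
      simpa using hg⟩⟩
  | one => exact ⟨[], by simp, by simp⟩
  | mul x y _ _ hx hy =>
    obtain ⟨l, rfl, hl⟩ := hx
    obtain ⟨l', rfl, hl'⟩ := hy
    exact ⟨l ++ l', by simp, fun g hg => (List.mem_append.1 hg).elim (hl g) (hl' g)⟩
  | inv x _ hx =>
    obtain ⟨l, rfl, hl⟩ := hx
    refine ⟨(l.map (·⁻¹)).reverse, List.prod_inv_reverse l, fun g hg => ?_⟩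
    obtain ⟨g', hg', rfl⟩ := List.mem_map.1 (List.mem_reverse.1 hg)
    obtain ⟨u, r, ε, hr, hε, rfl⟩ := hl g' hg'
    refine ⟨u, r, -ε, hr, by lia, ?_⟩
    rw [zpow_neg]; group

theorem exists_isConjProd_of_mem_normalClosure {R : Set F} {w : F}
    (hw : w ∈ Subgroup.normalClosure R) : ∃ N, IsConjProd R N w := by
  obtain ⟨l, rfl, hl⟩ := exists_list_of_mem_normalClosure hw
  exact ⟨_, exists_isConjProd_of_list l hl⟩

theorem commute_conj_pow {G : Type*} [Group G] {a s t : G} (h₁ : Commute a (t⁻¹ * a * t))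
    (h₂ : Commute s t) (h₃ : s⁻¹ * a * s = a * (t⁻¹ * a * t)) (n : ℕ) :
    Commute a ((t ^ n)⁻¹ * a * t ^ n) := by
  have key (m k : ℕ) (h : Commute a ((t ^ k)⁻¹ * a * t ^ k)) :
      Commute ((t ^ m)⁻¹ * a * t ^ m) ((t ^ (m + k))⁻¹ * a * t ^ (m + k)) := by
    have := (Commute.conj_iff (t ^ m)⁻¹).2 h
    convert this using 1
    · rw [inv_inv]
    · rw [add_comm m k, pow_add]; group
  have hs (m : ℕ) : s⁻¹ * ((t ^ m)⁻¹ * a * t ^ m) * s⁻¹⁻¹ =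
      ((t ^ m)⁻¹ * a * t ^ m) * ((t ^ (m + 1))⁻¹ * a * t ^ (m + 1)) := by
    have hc : Commute s (t ^ m) := h₂.pow_right m
    calc s⁻¹ * ((t ^ m)⁻¹ * a * t ^ m) * s⁻¹⁻¹
        = (t ^ m * s)⁻¹ * a * (t ^ m * s) := by group
      _ = (t ^ m)⁻¹ * (s⁻¹ * a * s) * t ^ m := by rw [← hc.eq]; group
      _ = _ := by rw [h₃, pow_succ']; group
  induction n using Nat.twoStepInduction with
  | zero => simp
  | one => simpa using h₁
  | more n ih ih' =>
    have h := (Commute.conj_iff s⁻¹).2 ih'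
    rw [hs] at h
    have h0 : s⁻¹ * a * s⁻¹⁻¹ = a * (t⁻¹ * a * t) := by rw [inv_inv, h₃]
    rw [h0] at h
    have k1 := key 1 n ih
    have k2 := key 1 (n + 1) ih'
    rw [add_comm 1] at k1 k2
    rw [pow_one] at k1 k2
    have e : n + 1 + 1 = n + 2 := rfl
    rw [e] at h k2
    generalize (t ^ (n + 1))⁻¹ * a * t ^ (n + 1) = x at *
    generalize (t ^ (n + 2))⁻¹ * a * t ^ (n + 2) = y at *
    generalize t⁻¹ * a * t = b at *
    have hb : Commute a (x * y) := by
      have := h.mul_left (k1.mul_right k2).inv_left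
      rwa [mul_inv_cancel_right] at this
    have := ih'.inv_right.mul_right hb
    rwa [inv_mul_cancel_left] at this

theorem cmm_a_conj_mem_normalClosure (n : ℕ) :
    cmm a ((t ^ n)⁻¹ * a * t ^ n) ∈ Subgroup.normalClosure RΓ := by
  have hrel {r : F} (hr : r ∈ RΓ) : QuotientGroup.mk' (Subgroup.normalClosure RΓ) r = 1 :=
    (QuotientGroup.eq_one_iff r).2 (Subgroup.subset_normalClosure hr)
  have hcmm {G : Type} [Group G] {x y : G} (h : x⁻¹ * y⁻¹ * x * y = 1) : Commute x y := by
    have : (y * x)⁻¹ * (x * y) = 1 := by rw [← h]; group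
    exact (inv_mul_eq_one.1 this).symm
  rw [← QuotientGroup.eq_one_iff]
  set f := QuotientGroup.mk' (Subgroup.normalClosure RΓ)
  have h₁ := hrel (r := cmm a (t⁻¹ * a * t)) (by simp [RΓ])
  have h₂ := hrel (r := cmm s t) (by simp [RΓ])
  have h₃ := hrel (r := (s⁻¹ * a * s)⁻¹ * a * (t⁻¹ * a * t)) (by simp [RΓ])
  simp only [cmm, map_mul, map_inv] at h₁ h₂ h₃
  rw [mul_assoc (_⁻¹), inv_mul_eq_one] at h₃
  have h := commute_conj_pow (hcmm h₁) (hcmm h₂) h₃ n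
  change f _ = 1
  simp only [cmm, map_mul, map_inv, map_pow]
  rw [mul_assoc, h.eq]
  group

theorem length_toWord_cmm_a_conj (n : ℕ) (hn : 1 ≤ n) :
    (FreeGroup.toWord (cmm a ((t ^ n)⁻¹ * a * t ^ n))).length = 4 * n + 4 := by
  have ht : (t ^ n : F) = FreeGroup.mk (List.replicate n (Letter.t, true)) := by
    rw [t, FreeGroup.of, ← FreeGroup.mk_toWord (x := FreeGroup.mk _ ^ n)]
    congr 1
    exact FreeGroup.toWord_of_pow _ _
  have hw : cmm a ((t ^ n)⁻¹ * a * t ^ n) = FreeGroup.mk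
      ([(Letter.a, false)] ++ (List.replicate n (Letter.t, false) ++ ([(Letter.a, false)] ++
      (List.replicate n (Letter.t, true) ++ ([(Letter.a, true)] ++
      (List.replicate n (Letter.t, false) ++ ([(Letter.a, true)] ++
      List.replicate n (Letter.t, true)))))))) := by
    rw [cmm, ht, a, FreeGroup.of]
    simp [FreeGroup.inv_mk, FreeGroup.mul_mk, FreeGroup.invRev]
  rw [hw, FreeGroup.toWord_mk, FreeGroup.IsReduced.reduce_eq]
  · simp; ring
  · obtain ⟨m, rfl⟩ : ∃ m, n = m + 1 := ⟨n - 1, by lia⟩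
    simp [FreeGroup.IsReduced, List.isChain_append, List.isChain_cons, List.head?_replicate,
      List.getLast?_replicate, List.head?_append, List.isChain_replicate_of_rel]

end BaumslagGroup

open BaumslagGroup

/-- The exponential lower bound half of Theorem 1: for every `n ≥ 1` the word
`[a, t⁻ⁿ·a·tⁿ]` has length `4n + 4`, represents the identity of Baumslag's group,
and its area is at least the `n`-th Fibonacci number.  In particular the Dehn
function of Baumslag's group grows at least exponentially. -/
theorem baumslag_dehn_exponential_lower_bound :
    ∀ n : ℕ, 1 ≤ n →
      (FreeGroup.toWord (cmm a ((t ^ n)⁻¹ * a * t ^ n))).length = 4 * n + 4 ∧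
      cmm a ((t ^ n)⁻¹ * a * t ^ n) ∈ Subgroup.normalClosure RΓ ∧
      Nat.fib n ≤ area RΓ (cmm a ((t ^ n)⁻¹ * a * t ^ n)) := by
  intro n hn
  refine ⟨length_toWord_cmm_a_conj n hn, cmm_a_conj_mem_normalClosure n, ?_⟩
  have hne := exists_isConjProd_of_mem_normalClosure (cmm_a_conj_mem_normalClosure n)
  obtain ⟨m, rfl⟩ := Nat.exists_eq_add_of_le' hn
  exact fib_le_of_isConjProd (Nat.sInf_mem hne)
end

section
/- Let m ≥ 2. For every n ≥ 1, every word w in the free group F on {a,s,t} of length at most n lying in the normal closure of R_m satisfies Area(w) ≤ 4n³ + n·K_m(n) + 12n²·K_m(n) + 8mn², where K_m(n) := 10m²n² + 10. In particular, the Dehn function of Γ_m is bounded above by C_m·n⁴ for a constant C_m depending only on m. -/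
/-- The relator set of the torsion analogue `Γ_m`:
`⟨a,s,t | [a, a^t] = 1, [s,t] = 1, a^s = a·a^t, a^m = 1⟩`. -/
def Rm (m : ℕ) : Set F :=
  {cmm a (t⁻¹ * a * t), cmm s t, (s⁻¹ * a * s)⁻¹ * a * (t⁻¹ * a * t), a ^ m}

/-- `K_m(n) = 10 m² n² + 10`. -/
def Km (m n : ℕ) : ℕ := 10 * m ^ 2 * n ^ 2 + 10

namespace BaumslagTorsion

open Polynomial

/-- `w` is a product of at most `N` conjugates of elements of `R^±1`. -/
inductive Fill (R : Set F) : ℕ → F → Prop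
  | one (N : ℕ) : Fill R N 1
  | step {N : ℕ} {w : F} (u r : F) (ε : ℤ) (hr : r ∈ R) (hε : ε = 1 ∨ ε = -1)
      (h : Fill R N w) : Fill R (N + 1) (u * r ^ ε * u⁻¹ * w)

namespace Fill

variable {R : Set F} {N M : ℕ} {v w : F}

theorem exists_isConjProd (h : Fill R N w) : ∃ N' ≤ N, IsConjProd R N' w := by
  induction h with
  | one N => exact ⟨0, Nat.zero_le _, Fin.elim0, Fin.elim0, Fin.elim0, by simp⟩
  | step u r ε hr hε _ ih =>
    obtain ⟨N', hN, us, rs, es, h1, h2, h3⟩ := ih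
    refine ⟨N' + 1, by omega, Fin.cons u us, Fin.cons r rs, Fin.cons ε es, ?_, ?_, ?_⟩
    · intro i
      refine Fin.cases ?_ (fun i => ?_) i
      · simpa using hr
      · simpa using h1 i
    · intro i
      refine Fin.cases ?_ (fun i => ?_) i
      · simpa using hε
      · simpa using h2 i
    · rw [h3, List.ofFn_succ, List.prod_cons]
      simp

theorem area_le (h : Fill R N w) : area R w ≤ N := by
  obtain ⟨N', hN, h'⟩ := h.exists_isConjProd
  exact (Nat.sInf_le h').trans hN

theorem mono (h : Fill R N w) : ∀ {M : ℕ}, N ≤ M → Fill R M w := by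
  induction h with
  | one N => exact fun _ => one _
  | step u r ε hr hε _ ih =>
    intro M hM
    obtain ⟨k, rfl⟩ : ∃ k, M = k + 1 := ⟨M - 1, by omega⟩
    exact step u r ε hr hε (ih (by omega))

theorem mul (h : Fill R N v) (h' : Fill R M w) : Fill R (N + M) (v * w) := by
  induction h with
  | one N => simpa using h'.mono (Nat.le_add_left M N)
  | step u r ε hr hε _ ih =>
    rw [mul_assoc, Nat.add_right_comm]
    exact step u r ε hr hε ih

theorem conj (h : Fill R N w) (g : F) : Fill R N (g * w * g⁻¹) := by
  induction h with
  | one N => simpa using one N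
  | step u r ε hr hε _ ih =>
    convert step (g * u) r ε hr hε ih using 1
    group

theorem inv (h : Fill R N w) : Fill R N w⁻¹ := by
  induction h with
  | one N => simpa using one N
  | step u r ε hr hε _ ih =>
    have h1 := step u r (-ε) hr (by omega) (one 0)
    convert ih.mul h1 using 1
    group

theorem of_mem (h : w ∈ R) : Fill R 1 w := by
  simpa using step 1 w 1 h (Or.inl rfl) (one 0)

theorem map_eq_one {G : Type*} [Group G] (φ : F →* G) (hφ : ∀ r ∈ R, φ r = 1)
    (h : Fill R N w) : φ w = 1 := by
  induction h with
  | one N => simp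
  | step u r ε hr hε _ ih => simp [hφ r hr, ih]

end Fill

/-- `u` can be rewritten as `v` with at most `N` applications of the relators of `Γ_m`. -/
def Near (m N : ℕ) (u v : F) : Prop := Fill (Rm m) N (u * v⁻¹)

namespace Near

variable {m N M : ℕ} {u u' v v' w : F}

theorem refl (u : F) : Near m 0 u u := by
  simpa [Near] using Fill.one (R := Rm m) 0

theorem of_eq (h : u = v) : Near m 0 u v := h ▸ refl u

theorem mono (h : Near m N u v) (hN : N ≤ M) : Near m M u v := Fill.mono h hN

theorem symm (h : Near m N u v) : Near m N v u := by
  simpa [Near] using Fill.inv h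

theorem trans (h : Near m N u v) (h' : Near m M v w) : Near m (N + M) u w := by
  simpa [Near, mul_assoc] using Fill.mul h h'

theorem mul (h : Near m N u u') (h' : Near m M v v') : Near m (N + M) (u * v) (u' * v') := by
  have := Fill.mul (Fill.conj h' u) h
  unfold Near
  rw [add_comm]
  convert this using 1
  group

theorem mul_left (g : F) (h : Near m N u v) : Near m N (g * u) (g * v) := by
  simpa using (refl g).mul h

theorem mul_right (g : F) (h : Near m N u v) : Near m N (u * g) (v * g) := by
  simpa using h.mul (refl g)

theorem conj (g : F) (h : Near m N u v) : Near m N (g⁻¹ * u * g) (g⁻¹ * v * g) :=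
  (h.mul_left _).mul_right _

theorem pow (h : Near m N u v) (c : ℕ) : Near m (c * N) (u ^ c) (v ^ c) := by
  induction c with
  | zero => simpa using refl (m := m) 1
  | succ c ih =>
    rw [pow_succ, pow_succ, Nat.succ_mul]
    exact ih.mul h

theorem pow_mul_comm (h : Near m N (u * v) (v * u)) (c : ℕ) :
    Near m (c * N) (u ^ c * v) (v * u ^ c) := by
  have := (h.mul_right v⁻¹).pow c
  have e : (u * v * v⁻¹) ^ c = u ^ c := by simp
  rw [e, conj_pow] at this
  simpa using this.mul_right v

theorem mul_pow (h : Near m 1 (u * v) (v * u)) (c : ℕ) :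
    Near m (c * c) ((u * v) ^ c) (u ^ c * v ^ c) := by
  induction c with
  | zero => simpa using refl (m := m) 1
  | succ c ih =>
    have h1 := ih.mul_right (u * v)
    have h2 := ((h.symm.pow_mul_comm c).mul_left (u ^ c)).mul_right v
    have h3 : Near m (c * c + c * 1) ((u * v) ^ c * (u * v)) (u ^ (c + 1) * v ^ (c + 1)) :=
      h1.trans (by convert h2 using 1 <;> simp only [pow_succ, mul_assoc])
    rw [pow_succ]
    exact h3.mono (by nlinarith)

theorem map_eq {G : Type*} [Group G] (φ : F →* G) (hφ : ∀ r ∈ Rm m, φ r = 1)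
    (h : Near m N u v) : φ u = φ v := by
  have := Fill.map_eq_one φ hφ h
  rwa [map_mul, map_inv, mul_inv_eq_one] at this

end Near

section Relators

variable (m : ℕ)

theorem near_of_cmm_mem {x y : F} (h : cmm x y ∈ Rm m) : Near m 1 (x * y) (y * x) := by
  have := (Fill.of_mem h).conj (y * x)
  unfold Near
  convert this using 1
  simp [cmm, mul_assoc]

theorem near_a_conj_t : Near m 1 (a * (t⁻¹ * a * t)) (t⁻¹ * a * t * a) :=
  near_of_cmm_mem m (by simp [Rm])

theorem near_s_t : Near m 1 (s * t) (t * s) :=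
  near_of_cmm_mem m (by simp [Rm])

theorem near_a_conj_s : Near m 1 (s⁻¹ * a * s) (a * (t⁻¹ * a * t)) := by
  have h : Fill (Rm m) 1 ((s⁻¹ * a * s)⁻¹ * a * (t⁻¹ * a * t)) := Fill.of_mem (by simp [Rm])
  have := h.inv.conj (s⁻¹ * a * s)
  unfold Near
  convert this using 1
  group

theorem near_a_pow (r q : ℕ) : Near m q (a ^ (r + m * q)) (a ^ r) := by
  have h : Near m 1 (a ^ m) 1 := by
    unfold Near
    simpa using Fill.of_mem (R := Rm m) (w := a ^ m) (by simp [Rm])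
  have := (h.pow q).mul_left (a ^ r)
  simpa [pow_add, pow_mul] using this

theorem near_conj_s_conj_t (u : F) :
    Near m 2 (s⁻¹ * (t⁻¹ * u * t) * s) (t⁻¹ * (s⁻¹ * u * s) * t) := by
  have h1 : Near m 1 (s * t) (t * s) := near_s_t m
  have h2 : Near m 1 (s⁻¹ * t⁻¹) (t⁻¹ * s⁻¹) := by
    have := ((h1.mul_left (t⁻¹ * s⁻¹)).mul_right (s⁻¹ * t⁻¹))
    convert this using 1 <;> group
  have := (h2.mul_right u).mul h1.symm
  convert this using 1 <;> group

variable [NeZero m]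

theorem near_a_pow_val_add (c e : ZMod m) :
    Near m 1 (a ^ c.val * a ^ e.val) (a ^ (c + e).val) := by
  rw [← pow_add, ZMod.val_add]
  have h := near_a_pow m ((c.val + e.val) % m) ((c.val + e.val) / m)
  rw [Nat.mod_add_div] at h
  refine h.mono ?_
  have h1 := c.val_lt
  have h2 := e.val_lt
  have : (c.val + e.val) / m < 2 := Nat.div_lt_of_lt_mul (by omega)
  omega

theorem near_a_inv (hm : 2 ≤ m) : Near m 1 a⁻¹ (a ^ (-1 : ZMod m).val) := by
  have : Fact (1 < m) := ⟨hm⟩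
  have h := (near_a_pow_val_add m 1 (-1)).mul_left a⁻¹
  simp only [ZMod.val_one, pow_one, inv_mul_cancel_left, add_neg_cancel, ZMod.val_zero,
    pow_zero, mul_one] at h
  exact h.symm

theorem near_conj_s_a_pow (c : ZMod m) :
    Near m (m * m) (s⁻¹ * a ^ c.val * s) (a ^ c.val * (t⁻¹ * a ^ c.val * t)) := by
  have h1 := (near_a_conj_s m).pow c.val
  have h2 := (near_a_conj_t m).mul_pow c.val
  have h3 := h1.trans h2
  have e (g : F) : (g⁻¹ * a * g) ^ c.val = g⁻¹ * a ^ c.val * g := by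
    simpa using conj_pow (i := c.val) (a := g⁻¹) (b := a)
  rw [e, e] at h3
  refine h3.mono ?_
  have := c.val_lt
  nlinarith

end Relators

section NormalForm

variable {m : ℕ}

/-- The normal form `a^{c₀} (a^{c₁})^t ⋯ (a^{cₙ₋₁})^{t^{n-1}}` of the polynomial `∑ cᵢ Xⁱ`. -/
noncomputable def normalForm : ℕ → (ZMod m)[X] → F
  | 0, _ => 1
  | n + 1, p => a ^ (p.coeff 0).val * (t⁻¹ * normalForm n p.divX * t)

theorem normalForm_zero (n : ℕ) : normalForm n (0 : (ZMod m)[X]) = 1 := by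
  induction n with
  | zero => rfl
  | succ n ih => simp [normalForm, ih]

theorem degree_divX_lt_of_lt_succ {p : (ZMod m)[X]} {n : ℕ} (hp : p.degree < (n + 1 : ℕ)) :
    p.divX.degree < n := by
  rw [degree_lt_iff_coeff_zero] at hp ⊢
  intro i hi
  rw [coeff_divX]
  exact hp _ (by omega)

theorem normalForm_add_right {n : ℕ} (k : ℕ) {p : (ZMod m)[X]} (hp : p.degree < n) :
    normalForm (n + k) p = normalForm n p := by
  induction n generalizing p with
  | zero =>
    obtain rfl : p = 0 := by simpa using hp
    simp [normalForm_zero]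
  | succ n ih =>
    rw [Nat.add_right_comm]
    simp only [normalForm]
    rw [ih (degree_divX_lt_of_lt_succ hp)]

theorem normalForm_X_pow_mul (n i : ℕ) (p : (ZMod m)[X]) :
    normalForm (n + i) (X ^ i * p) = (t ^ i)⁻¹ * normalForm n p * t ^ i := by
  induction i with
  | zero => simp
  | succ i ih =>
    have h : (X ^ (i + 1) * p).divX = X ^ i * p := by
      ext j
      rw [coeff_divX, pow_succ', mul_assoc, coeff_X_mul]
    rw [← add_assoc, normalForm, h, ih, pow_succ' X, mul_assoc X, coeff_X_mul_zero,
      ZMod.val_zero, pow_zero, one_mul, pow_succ t]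
    group

theorem degree_pushed_lt {n : ℕ} (e d : ZMod m) {p : (ZMod m)[X]} (hp : p.degree < n) :
    (C e + (X + 1) * p + C d * X ^ n).degree < ((n + 1 : ℕ) : WithBot ℕ) := by
  rw [degree_lt_iff_coeff_zero] at hp ⊢
  intro i hi
  obtain ⟨j, rfl⟩ : ∃ j, i = j + 1 := ⟨i - 1, by omega⟩
  simp [add_mul, coeff_X_pow, hp j (by omega), hp (j + 1) (by omega)]
  omega

theorem exists_eq_C_add {n : ℕ} {p : (ZMod m)[X]} (hm : 2 ≤ m) (hp : p.degree < (n + 1 : ℕ)) :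
    ∃ (c : ZMod m) (q : (ZMod m)[X]), q.degree < n ∧ p = C c + (X + 1) * q := by
  have : Fact (1 < m) := ⟨hm⟩
  have hX : (X + 1 : (ZMod m)[X]) = X - C (-1) := by simp
  refine ⟨p.eval (-1), p /ₘ (X - C (-1)), ?_, ?_⟩
  · by_cases h0 : p = 0
    · simp [h0]
    · have h1 := degree_divByMonic_lt p (q := X - C (-1)) h0
        (by rw [degree_X_sub_C]; exact zero_lt_one)
      rw [degree_eq_natDegree h0] at h1 hp
      refine h1.trans_le ?_
      norm_cast at hp ⊢
      omega
  · have h := modByMonic_add_div p (X - C (-1))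
    rw [modByMonic_X_sub_C_eq_C_eval] at h
    rw [hX, h]

theorem exists_eq_add_X_pow {n : ℕ} {p : (ZMod m)[X]} (hm : 2 ≤ m)
    (hp : p.degree < (n + 1 : ℕ)) :
    ∃ (d : ZMod m) (q : (ZMod m)[X]), q.degree < n ∧ p = (X + 1) * q + C d * X ^ n := by
  have : Fact (1 < m) := ⟨hm⟩
  obtain ⟨c, q, hq, rfl⟩ := exists_eq_C_add hm hp
  obtain ⟨c', r, hr, h⟩ := exists_eq_C_add hm (p := (X ^ n : (ZMod m)[X])) (n := n)
    (by rw [degree_X_pow]; exact_mod_cast n.lt_succ_self)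
  have hc : c' = (-1) ^ n := by
    have := congrArg (eval (-1)) h
    simpa using this.symm
  refine ⟨c * (-1) ^ n, q - C (c * (-1) ^ n) * r, ?_, ?_⟩
  · rw [degree_lt_iff_coeff_zero] at hq hr ⊢
    intro i hi
    rw [coeff_sub, coeff_C_mul, hq i hi, hr i hi, mul_zero, sub_zero]
  · have h2 : ((-1 : ZMod m) ^ n) * (-1) ^ n = 1 := by rw [← mul_pow]; simp
    have h3 : C (c * (-1) ^ n) * (X ^ n : (ZMod m)[X]) =
        C c + (X + 1) * (C (c * (-1) ^ n) * r) := by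
      conv_lhs => rw [h, hc]
      rw [mul_add, ← C_mul, mul_assoc, h2]
      ring
    rw [h3]
    ring

variable [NeZero m]

/-- Conjugating a normal form by `s` multiplies its polynomial by `X + 1`, and at the two ends
powers of `a` and `a^{t^n}` can be absorbed. -/
theorem near_conj_s_normalForm {n : ℕ} (e d : ZMod m) {p : (ZMod m)[X]} (hp : p.degree < n)
    (hm : 2 ≤ m) :
    Near m (2 * (m * m) * n + 1)
      (a ^ e.val * (s⁻¹ * normalForm n p * s) * ((t ^ n)⁻¹ * a ^ d.val * t ^ n))
      (normalForm (n + 1) (C e + (X + 1) * p + C d * X ^ n)) := by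
  induction n generalizing e p with
  | zero =>
    obtain rfl : p = 0 := by simpa using hp
    simpa [normalForm] using near_a_pow_val_add m e d
  | succ n ih =>
    have h0 : (C e + (X + 1) * p + C d * X ^ (n + 1)).coeff 0 = e + p.coeff 0 := by
      simp [add_mul]
    have h1 : (C e + (X + 1) * p + C d * X ^ (n + 1)).divX =
        C (p.coeff 0) + (X + 1) * p.divX + C d * X ^ n := by
      ext j
      simp only [coeff_divX, coeff_add, add_mul, one_mul, coeff_X_mul, coeff_C_mul, coeff_X_pow,
        coeff_C]
      rcases j with _ | j
      · cases n <;> simp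
      · simp [coeff_divX]
    have h2 := (ih (p.coeff 0) (degree_divX_lt_of_lt_succ hp)).conj t
    have h3 := (near_a_pow_val_add m e (p.coeff 0)).mul h2
    have hR : normalForm (n + 1 + 1) (C e + (X + 1) * p + C d * X ^ (n + 1)) =
        a ^ (e + p.coeff 0).val *
          (t⁻¹ * normalForm (n + 1) (C (p.coeff 0) + (X + 1) * p.divX + C d * X ^ n) * t) := by
      rw [normalForm, h0, h1]
    rw [← hR] at h3
    have h4 := (near_conj_s_a_pow m (p.coeff 0)).mul (near_conj_s_conj_t m (normalForm n p.divX))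
    have h5 := (h4.mul_left (a ^ e.val)).mul_right ((t ^ (n + 1))⁻¹ * a ^ d.val * t ^ (n + 1))
    have hM : a ^ e.val * (a ^ (p.coeff 0).val * (t⁻¹ * a ^ (p.coeff 0).val * t) *
          (t⁻¹ * (s⁻¹ * normalForm n p.divX * s) * t)) *
          ((t ^ (n + 1))⁻¹ * a ^ d.val * t ^ (n + 1)) =
        a ^ e.val * a ^ (p.coeff 0).val * (t⁻¹ * (a ^ (p.coeff 0).val *
          (s⁻¹ * normalForm n p.divX * s) * ((t ^ n)⁻¹ * a ^ d.val * t ^ n)) * t) := by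
      rw [pow_succ t]
      group
    have hL : a ^ e.val * (s⁻¹ * normalForm (n + 1) p * s) *
          ((t ^ (n + 1))⁻¹ * a ^ d.val * t ^ (n + 1)) =
        a ^ e.val * (s⁻¹ * a ^ (p.coeff 0).val * s *
          (s⁻¹ * (t⁻¹ * normalForm n p.divX * t) * s)) *
          ((t ^ (n + 1))⁻¹ * a ^ d.val * t ^ (n + 1)) := by
      rw [normalForm]
      group
    rw [hM] at h5
    rw [hL]
    exact (h5.trans h3).mono (by nlinarith)

theorem near_normalForm_mul {n : ℕ} {p q : (ZMod m)[X]} (hm : 2 ≤ m) (hp : p.degree < n)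
    (hq : q.degree < n) :
    Near m (3 * (m * m) * (n * (n + 1))) (normalForm n p * normalForm n q)
      (normalForm n (p + q)) := by
  induction n generalizing p q with
  | zero => simpa [normalForm] using Near.refl (m := m) 1
  | succ n ih =>
    obtain ⟨c, p', hp', rfl⟩ := exists_eq_C_add hm hp
    obtain ⟨d, q', hq', rfl⟩ := exists_eq_add_X_pow hm hq
    have h1 := near_conj_s_normalForm c 0 hp' hm
    have h2 := near_conj_s_normalForm 0 d hq' hm
    simp only [ZMod.val_zero, pow_zero, mul_one, inv_mul_cancel, one_mul, map_zero, zero_mul,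
      add_zero, zero_add] at h1 h2
    have h3 := near_conj_s_normalForm c d (p := p' + q')
      ((degree_add_le _ _).trans_lt (max_lt hp' hq')) hm
    have h4 := (((ih hp' hq').conj s).mul_left (a ^ c.val)).mul_right
      ((t ^ n)⁻¹ * a ^ d.val * t ^ n)
    have h5 : a ^ c.val * (s⁻¹ * (normalForm n p' * normalForm n q') * s) *
          ((t ^ n)⁻¹ * a ^ d.val * t ^ n) =
        a ^ c.val * (s⁻¹ * normalForm n p' * s) *
          (s⁻¹ * normalForm n q' * s * ((t ^ n)⁻¹ * a ^ d.val * t ^ n)) := by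
      group
    rw [h5] at h4
    have h6 := (h1.mul h2).symm.trans (h4.trans h3)
    have e : C c + (X + 1) * p' + ((X + 1) * q' + C d * X ^ n) =
      C c + (X + 1) * (p' + q') + C d * X ^ n := by ring
    rw [e]
    refine h6.mono ?_
    have : 1 ≤ m * m := by nlinarith
    nlinarith

theorem exists_near_conj_s_pow (hm : 2 ≤ m) (c : ZMod m) (j : ℕ) :
    ∃ q : (ZMod m)[X], q.degree < (j + 1 : ℕ) ∧
      Near m (2 * (m * m) * (j * (j + 1))) ((s ^ j)⁻¹ * a ^ c.val * s ^ j)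
        (normalForm (j + 1) q) := by
  induction j with
  | zero =>
    refine ⟨C c, degree_C_le.trans_lt (by simp), ?_⟩
    simpa [normalForm] using Near.refl (m := m) _
  | succ j ih =>
    obtain ⟨q, hq, h⟩ := ih
    refine ⟨_, degree_pushed_lt 0 0 hq, ?_⟩
    have h1 := near_conj_s_normalForm 0 0 hq hm
    have h2 := (h.conj s).trans (by simpa using h1)
    simp only [map_zero, zero_mul, add_zero, zero_add]
    refine Near.mono (N := 2 * (m * m) * (j * (j + 1)) + (2 * (m * m) * (j + 1) + 1)) ?_ ?_
    · convert h2 using 1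
      simp only [pow_succ]
      group
    · have : 1 ≤ m * m := by nlinarith
      nlinarith

end NormalForm

section Representation

variable (m : ℕ)

/-- The variable as a unit of the ring of Laurent series. -/
noncomputable def unitX : (LaurentSeries (ZMod m))ˣ where
  val := HahnSeries.single 1 1
  inv := HahnSeries.single (-1) 1
  val_inv := by simp
  inv_val := by simp

theorem exists_unit_eq_one_add_X :
    ∃ y : (LaurentSeries (ZMod m))ˣ, (y : LaurentSeries (ZMod m)) = 1 + unitX m := by
  have h : IsUnit (1 + PowerSeries.X : PowerSeries (ZMod m)) := by
    rw [PowerSeries.isUnit_iff_constantCoeff]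
    simp
  obtain ⟨y, hy⟩ := h.map (HahnSeries.ofPowerSeries ℤ (ZMod m))
  exact ⟨y, by rw [hy]; simp [unitX]⟩

/-- `1 + X` as a unit of the ring of Laurent series. -/
noncomputable def unitY : (LaurentSeries (ZMod m))ˣ := (exists_unit_eq_one_add_X m).choose

theorem unitY_eq : (unitY m : LaurentSeries (ZMod m)) = 1 + unitX m :=
  (exists_unit_eq_one_add_X m).choose_spec

/-- The action of `F` on Laurent series by affine maps: `a` translates by `1`, while `t` and `s`
divide by `X` and `1 + X`. -/
noncomputable def affineRep : F →* Equiv.Perm (LaurentSeries (ZMod m)) :=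
  FreeGroup.lift fun
    | .a => Equiv.addRight 1
    | .s => (Units.mulLeft (unitY m))⁻¹
    | .t => (Units.mulLeft (unitX m))⁻¹

theorem affineRep_a : affineRep m a = Equiv.addRight 1 := FreeGroup.lift_apply_of

theorem affineRep_s : affineRep m s = (Units.mulLeft (unitY m))⁻¹ := FreeGroup.lift_apply_of

theorem affineRep_t : affineRep m t = (Units.mulLeft (unitX m))⁻¹ := FreeGroup.lift_apply_of

theorem affineRep_a_pow (k : ℕ) (v : LaurentSeries (ZMod m)) :
    affineRep m (a ^ k) v = v + k := by
  induction k generalizing v with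
  | zero => simp
  | succ k ih =>
    rw [pow_succ, map_mul, Equiv.Perm.mul_apply, ih, affineRep_a]
    simp only [Equiv.coe_addRight, Nat.cast_add, Nat.cast_one]
    ring

theorem affineRep_conj_t {u : F} {z : LaurentSeries (ZMod m)}
    (h : ∀ v, affineRep m u v = v + z) (v : LaurentSeries (ZMod m)) :
    affineRep m (t⁻¹ * u * t) v = v + unitX m * z := by
  have : affineRep m (t⁻¹ * u * t) v =
      unitX m * affineRep m u (((unitX m)⁻¹ : (LaurentSeries (ZMod m))ˣ) * v) := by
    simp [affineRep_t]
  rw [this, h, mul_add, Units.mul_inv_cancel_left]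

theorem affineRep_conj_s {u : F} {z : LaurentSeries (ZMod m)}
    (h : ∀ v, affineRep m u v = v + z) (v : LaurentSeries (ZMod m)) :
    affineRep m (s⁻¹ * u * s) v = v + unitY m * z := by
  have : affineRep m (s⁻¹ * u * s) v =
      unitY m * affineRep m u (((unitY m)⁻¹ : (LaurentSeries (ZMod m))ˣ) * v) := by
    simp [affineRep_s]
  rw [this, h, mul_add, Units.mul_inv_cancel_left]

theorem map_cmm_eq_one {G : Type*} [Group G] (φ : F →* G) {x y : F}
    (h : φ x * φ y = φ y * φ x) : φ (cmm x y) = 1 := by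
  simp only [cmm, map_mul, map_inv]
  rw [mul_assoc, h]
  group

theorem affineRep_relator {r : F} (hr : r ∈ Rm m) : affineRep m r = 1 := by
  have ha (v : LaurentSeries (ZMod m)) : affineRep m a v = v + 1 := by
    simp [affineRep_a]
  have ht := affineRep_conj_t m ha
  have hs := affineRep_conj_s m ha
  simp only [Rm, Set.mem_insert_iff, Set.mem_singleton_iff] at hr
  rcases hr with rfl | rfl | rfl | rfl
  · refine map_cmm_eq_one _ (Equiv.ext fun v => ?_)
    rw [Equiv.Perm.mul_apply, Equiv.Perm.mul_apply, ha, ht, ha, ht]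
    ring
  · refine map_cmm_eq_one _ ?_
    rw [affineRep_s, affineRep_t, ← mul_inv_rev, ← mul_inv_rev]
    congr 1
    ext1 v
    simp only [Equiv.Perm.mul_apply, Units.mulLeft_apply]
    ring
  · rw [mul_assoc, map_mul, map_inv, inv_mul_eq_one]
    ext1 v
    rw [hs, map_mul, Equiv.Perm.mul_apply, ht, ha, unitY_eq]
    ring
  · ext1 v
    rw [affineRep_a_pow]
    have : (m : LaurentSeries (ZMod m)) = 0 := by
      rw [← map_natCast (HahnSeries.C : ZMod m →+* LaurentSeries (ZMod m))]
      simp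
    simp [this]

/-- Evaluation of polynomials at the variable of the Laurent series ring. -/
noncomputable def evalX : (ZMod m)[X] →+* LaurentSeries (ZMod m) :=
  (HahnSeries.ofPowerSeries ℤ (ZMod m)).comp Polynomial.coeToPowerSeries.ringHom

theorem evalX_injective : Function.Injective (evalX m) := by
  intro p q h
  exact Polynomial.coe_injective _ (HahnSeries.ofPowerSeries_injective h)

theorem evalX_X : evalX m X = unitX m := by
  simp [evalX, unitX]

theorem affineRep_normalForm [NeZero m] {n : ℕ} {p : (ZMod m)[X]} (hp : p.degree < n)
    (v : LaurentSeries (ZMod m)) : affineRep m (normalForm n p) v = v + evalX m p := by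
  induction n generalizing p v with
  | zero =>
    obtain rfl : p = 0 := by simpa using hp
    simp [normalForm]
  | succ n ih =>
    have hc : (((p.coeff 0).val : ℕ) : LaurentSeries (ZMod m)) = evalX m (C (p.coeff 0)) := by
      conv_rhs => rw [← ZMod.natCast_zmod_val (p.coeff 0), map_natCast, map_natCast]
    have h1 := affineRep_conj_t m (ih (degree_divX_lt_of_lt_succ hp))
    rw [normalForm, map_mul, Equiv.Perm.mul_apply, h1, affineRep_a_pow, hc]
    conv_rhs => rw [← X_mul_divX_add p]
    rw [map_add, map_mul, evalX_X]
    ring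

/-- The exponent sum of the letter `x`. -/
def exponentSum (x : Letter) : F →* Multiplicative ℤ :=
  FreeGroup.lift fun y => if y = x then Multiplicative.ofAdd 1 else 1

theorem exponentSum_relator {x : Letter} (hx : x ≠ .a) {r : F} (hr : r ∈ Rm m) :
    exponentSum x r = 1 := by
  have ha : exponentSum x a = 1 := by simp [exponentSum, a, hx.symm]
  simp only [Rm, Set.mem_insert_iff, Set.mem_singleton_iff] at hr
  rcases hr with rfl | rfl | rfl | rfl
  · exact map_cmm_eq_one _ (mul_comm _ _)
  · exact map_cmm_eq_one _ (mul_comm _ _)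
  · simp [ha]
  · simp [ha]

end Representation

section Rewriting

variable {m : ℕ}

theorem near_s_pow_inv_t (j : ℕ) : Near m j ((s ^ j)⁻¹ * t) (t * (s ^ j)⁻¹) := by
  have h := (near_s_t m).pow_mul_comm j
  have := (h.mul_left (s ^ j)⁻¹).mul_right (s ^ j)⁻¹
  rw [mul_one] at this
  convert this.symm using 1 <;> group

theorem near_s_pow_inv_t_inv (j : ℕ) : Near m j ((s ^ j)⁻¹ * t⁻¹) (t⁻¹ * (s ^ j)⁻¹) := by
  have := ((near_s_pow_inv_t (m := m) j).mul_left t⁻¹).mul_right t⁻¹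
  convert this.symm using 1 <;> group

variable [NeZero m]

theorem exists_near_mul_a_pow (hm : 2 ≤ m) {n i j : ℕ} (hi : i ≤ 2 * n) (hj : j ≤ 2 * n)
    (c : ZMod m) :
    ∃ q : (ZMod m)[X], q.degree < (4 * n + 1 : ℕ) ∧
      Near m (2 * (m * m) * (2 * n * (2 * n + 1)))
        ((t ^ i)⁻¹ * (s ^ j)⁻¹ * a ^ c.val)
        (normalForm (4 * n + 1) q * ((t ^ i)⁻¹ * (s ^ j)⁻¹)) := by
  obtain ⟨q, hq, h⟩ := exists_near_conj_s_pow hm c j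
  have hd : (X ^ i * q).degree < ((j + 1 + i : ℕ) : WithBot ℕ) := by
    rw [degree_lt_iff_coeff_zero] at hq ⊢
    intro k hk
    rw [coeff_X_pow_mul', if_pos (by omega)]
    exact hq _ (by omega)
  refine ⟨X ^ i * q, hd.trans_le (by exact_mod_cast (by omega)), ?_⟩
  have e : normalForm (4 * n + 1) (X ^ i * q) = (t ^ i)⁻¹ * normalForm (j + 1) q * t ^ i := by
    rw [← normalForm_X_pow_mul, ← normalForm_add_right (4 * n - j - i) hd]
    congr 1
    omega
  rw [e]
  have h1 := (h.conj (t ^ i)).mul_right ((t ^ i)⁻¹ * (s ^ j)⁻¹)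
  refine Near.mono (N := 2 * (m * m) * (j * (j + 1))) ?_
    (Nat.mul_le_mul_left _ (Nat.mul_le_mul hj (by omega)))
  convert h1 using 1
  group

theorem exists_near_mul_letter (hm : 2 ≤ m) {n i j : ℕ} (hi : i ≤ 2 * n) (hj : j ≤ 2 * n)
    (hi0 : 1 ≤ i) (hj0 : 1 ≤ j) (x : Letter × Bool) :
    ∃ (q : (ZMod m)[X]) (i' j' : ℕ), q.degree < (4 * n + 1 : ℕ) ∧
      i' ≤ i + 1 ∧ i ≤ i' + 1 ∧ j' ≤ j + 1 ∧ j ≤ j' + 1 ∧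
      Near m (2 * (m * m) * (2 * n * (2 * n + 1)) + 1)
        ((t ^ i)⁻¹ * (s ^ j)⁻¹ * FreeGroup.mk [x])
        (normalForm (4 * n + 1) q * ((t ^ i')⁻¹ * (s ^ j')⁻¹)) := by
  have : Fact (1 < m) := ⟨hm⟩
  have hz : (0 : (ZMod m)[X]).degree < (4 * n + 1 : ℕ) := by
    rw [degree_zero]
    exact WithBot.bot_lt_coe _
  have hcost : j ≤ 2 * (m * m) * (2 * n * (2 * n + 1)) + 1 := by
    have : 1 ≤ m * m := by nlinarith
    nlinarith [Nat.mul_le_mul this (Nat.le_refl (2 * n * (2 * n + 1)))]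
  obtain ⟨i, rfl⟩ : ∃ k, i = k + 1 := ⟨i - 1, by omega⟩
  obtain ⟨j, rfl⟩ : ∃ k, j = k + 1 := ⟨j - 1, by omega⟩
  obtain ⟨x | x | x, b | b⟩ := x
  · obtain ⟨q, hq, h⟩ := exists_near_mul_a_pow hm hi hj (-1)
    refine ⟨q, i + 1, j + 1, hq, by omega, by omega, by omega, by omega, ?_⟩
    rw [add_comm]
    exact ((near_a_inv m hm).mul_left _).trans h
  · obtain ⟨q, hq, h⟩ := exists_near_mul_a_pow hm hi hj 1
    refine ⟨q, i + 1, j + 1, hq, by omega, by omega, by omega, by omega, ?_⟩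
    rw [ZMod.val_one, pow_one] at h
    exact h.mono (Nat.le_succ _)
  · refine ⟨0, i + 1, j + 2, hz, by omega, by omega, by omega, by omega, ?_⟩
    refine (Near.of_eq ?_).mono (Nat.zero_le _)
    change _ * s⁻¹ = _
    rw [normalForm_zero]
    group
  · refine ⟨0, i + 1, j, hz, by omega, by omega, by omega, by omega, ?_⟩
    refine (Near.of_eq ?_).mono (Nat.zero_le _)
    change _ * s = _
    rw [normalForm_zero]
    group
  · refine ⟨0, i + 2, j + 1, hz, by omega, by omega, by omega, by omega, ?_⟩
    refine Near.mono ?_ hcost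
    change Near m _ (_ * t⁻¹) _
    rw [normalForm_zero]
    convert (near_s_pow_inv_t_inv (m := m) (j + 1)).mul_left (t ^ (i + 1))⁻¹ using 1 <;> group
  · refine ⟨0, i, j + 1, hz, by omega, by omega, by omega, by omega, ?_⟩
    refine Near.mono ?_ hcost
    change Near m _ (_ * t) _
    rw [normalForm_zero]
    convert (near_s_pow_inv_t (m := m) (j + 1)).mul_left (t ^ (i + 1))⁻¹ using 1 <;> group

theorem exists_near_mul_word (hm : 2 ≤ m) (n : ℕ) (l : List (Letter × Bool)) :
    ∀ i j : ℕ, l.length ≤ i → l.length ≤ j → i + l.length ≤ 2 * n → j + l.length ≤ 2 * n →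
    ∃ (q : (ZMod m)[X]) (i' j' : ℕ), q.degree < (4 * n + 1 : ℕ) ∧
      Near m (l.length * (2 * (m * m) * (2 * n * (2 * n + 1)) + 1 +
          3 * (m * m) * ((4 * n + 1) * (4 * n + 1 + 1))))
        ((t ^ i)⁻¹ * (s ^ j)⁻¹ * FreeGroup.mk l)
        (normalForm (4 * n + 1) q * ((t ^ i')⁻¹ * (s ^ j')⁻¹)) := by
  induction l with
  | nil =>
    intro i j _ _ _ _
    refine ⟨0, i, j, by rw [degree_zero]; exact WithBot.bot_lt_coe _, (Near.of_eq ?_).mono (Nat.zero_le _)⟩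
    rw [normalForm_zero, ← FreeGroup.one_eq_mk]
    simp
  | cons x l ih =>
    intro i j hi hj hi' hj'
    rw [List.length_cons] at *
    obtain ⟨q, i₁, j₁, hq, h1, h2, h3, h4, h⟩ :=
      exists_near_mul_letter hm (n := n) (i := i) (j := j) (by omega) (by omega) (by omega)
        (by omega) x
    obtain ⟨q', i₂, j₂, hq', h'⟩ := ih i₁ j₁ (by omega) (by omega) (by omega) (by omega)
    refine ⟨q + q', i₂, j₂, (degree_add_le _ _).trans_lt (max_lt hq hq'), ?_⟩
    have e : FreeGroup.mk (x :: l) = FreeGroup.mk [x] * FreeGroup.mk l := by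
      rw [FreeGroup.mul_mk, List.singleton_append]
    have k1 := h.mul_right (FreeGroup.mk l)
    have k2 := h'.mul_left (normalForm (4 * n + 1) q)
    have k3 := (near_normalForm_mul hm hq hq').mul_right ((t ^ i₂)⁻¹ * (s ^ j₂)⁻¹)
    have k4 := ((k1.trans (Near.of_eq (mul_assoc _ _ _))).trans k2).trans
      ((Near.of_eq (mul_assoc _ _ _).symm).trans k3)
    rw [e, ← mul_assoc _ (FreeGroup.mk [x])]
    refine k4.mono (le_of_eq ?_)
    ring

theorem fill_of_mem_normalClosure (hm : 2 ≤ m) {w : F}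
    (hw : w ∈ Subgroup.normalClosure (Rm m)) {n : ℕ} (hn : w.toWord.length ≤ n) :
    Fill (Rm m) (n * (2 * (m * m) * (2 * n * (2 * n + 1)) + 1 +
      3 * (m * m) * ((4 * n + 1) * (4 * n + 1 + 1)))) w := by
  have ker {G : Type} [Group G] (φ : F →* G) (hφ : ∀ r ∈ Rm m, φ r = 1) : φ w = 1 :=
    Subgroup.normalClosure_le_normal (N := φ.ker) hφ hw
  obtain ⟨q, i, j, hq, h⟩ :=
    exists_near_mul_word hm n w.toWord n n hn hn (by omega) (by omega)
  rw [FreeGroup.mk_toWord] at h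
  have hq0 : q = 0 := by
    have h1 := h.map_eq (affineRep m) fun r => affineRep_relator m
    simp only [map_mul, ker (affineRep m) fun r => affineRep_relator m, mul_one] at h1
    have h2 := congrArg (fun f => f 0) h1
    simp only [Equiv.Perm.mul_apply, affineRep_normalForm m hq] at h2
    have fix (k l : ℕ) :
        affineRep m (t ^ k)⁻¹ (affineRep m (s ^ l)⁻¹ 0) = 0 := by
      have hs : affineRep m s 0 = 0 := by
        rw [affineRep_s, Equiv.Perm.inv_eq_iff_eq]; simp
      have ht : affineRep m t 0 = 0 := by
        rw [affineRep_t, Equiv.Perm.inv_eq_iff_eq]; simp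
      have hs' : affineRep m (s ^ l)⁻¹ 0 = 0 := by
        rw [map_inv, Equiv.Perm.inv_eq_iff_eq, map_pow]
        exact (Function.IsFixedPt.perm_pow hs l).symm
      rw [hs', map_inv, Equiv.Perm.inv_eq_iff_eq, map_pow]
      exact (Function.IsFixedPt.perm_pow ht k).symm
    rw [fix, fix, zero_add] at h2
    exact evalX_injective m (h2.symm.trans (map_zero _).symm)
  subst hq0
  rw [normalForm_zero, one_mul] at h
  have hs := h.map_eq (exponentSum .s) fun r => exponentSum_relator m (by decide)
  have ht := h.map_eq (exponentSum .t) fun r => exponentSum_relator m (by decide)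
  simp only [map_mul, map_inv, map_pow, ker (exponentSum .s) fun r => exponentSum_relator m
    (by decide), ker (exponentSum .t) fun r => exponentSum_relator m (by decide)] at hs ht
  have hj : n = j := by
    simpa [exponentSum, s, t, ← ofAdd_nsmul, ← ofAdd_neg] using hs
  have hi : n = i := by
    simpa [exponentSum, s, t, ← ofAdd_nsmul, ← ofAdd_neg] using ht
  subst hj
  subst hi
  have h1 := Fill.conj h ((t ^ n)⁻¹ * (s ^ n)⁻¹)⁻¹
  have h2 (g : F) : g⁻¹ * (g * w * g⁻¹) * g⁻¹⁻¹ = w := by group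
  rw [h2] at h1
  exact h1.mono (Nat.mul_le_mul_right _ hn)

end Rewriting

end BaumslagTorsion

/-- Theorem 2 (quartic upper bound for `Γ_m`): for `m ≥ 2` and `n ≥ 1`, every word of
length at most `n` representing the identity of `Γ_m` has area at most
`4n³ + n·K_m(n) + 12n²·K_m(n) + 8mn²`; in particular the Dehn function of `Γ_m` is at
most quartic. -/
theorem gamma_m_dehn_quartic_upper_bound :
    ∀ m : ℕ, 2 ≤ m → ∀ n : ℕ, 1 ≤ n → ∀ w : F,
      (FreeGroup.toWord w).length ≤ n →
      w ∈ Subgroup.normalClosure (Rm m) →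
      area (Rm m) w ≤ 4 * n ^ 3 + n * Km m n + 12 * n ^ 2 * Km m n + 8 * m * n ^ 2 := by
  intro m hm n hn w hw hmem
  have : NeZero m := ⟨by omega⟩
  refine (BaumslagTorsion.fill_of_mem_normalClosure hm hmem hw).area_le.trans ?_
  have h1 : 1 ≤ m * m := by nlinarith
  have h2 : 1 ≤ n * n := by nlinarith
  have h3 : n * n ≤ n * n * n := Nat.le_mul_of_pos_right _ hn
  have h4 : n * n * n ≤ n * n * n * n := Nat.le_mul_of_pos_right _ hn
  have h5 := Nat.mul_le_mul (Nat.le_refl (m * m)) h3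
  have h6 := Nat.mul_le_mul (Nat.le_refl (m * m)) h4
  have h7 : n ≤ n * n := Nat.le_mul_of_pos_right _ hn
  have h8 := Nat.mul_le_mul (Nat.le_refl (m * m)) h7
  unfold Km
  nlinarith
end
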